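/- arXiv:2511.12023 — 5 statements merged into one kernel-verified Lean document; each statement's English description precedes it below -/
import Mathlib

section
/- Let $T>0$, $\beta>1$ and $L\ge 0$, and let $k:[0,T]\times[0,T]\to[0,\infty)$ be measurable with $\int_0^t k(t,s)^{2\beta}\,ds \le L$ for every $t\in[0,T]$. Then there exists a constant $C>0$, depending only on $T$, $L$ and $\beta$, such that: for every $A\ge 0$ and every bounded measurable function $v:[0,T]\to[0,\infty)$ satisfying $v(t) \le A + \int_0^t k(t,s)^2\, v(s)\,ds$ for all $t\in[0,T]$, one has $v(t) \le C\,A$ for all $t\in[0,T]$. -/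
open MeasureTheory Set

/-- The exponential weight gains a factor `b⁻¹` under integration over `(0, t]`. -/
theorem lintegral_exp_mul_Ioc_le {b : ℝ} (hb : 0 < b) {t : ℝ} (ht : 0 ≤ t) :
    ∫⁻ s in Ioc (0:ℝ) t, ENNReal.ofReal (Real.exp (b * s)) ≤
      ENNReal.ofReal (Real.exp (b * t) / b) := by
  have hint : IntegrableOn (fun s => Real.exp (b * s)) (Ioc 0 t) :=
    (Continuous.integrableOn_Icc (by fun_prop)).mono_set Ioc_subset_Icc_self
  rw [← ofReal_integral_eq_lintegral_ofReal hint (ae_of_all _ fun s => (Real.exp_pos _).le),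
    ← intervalIntegral.integral_of_le ht]
  refine ENNReal.ofReal_le_ofReal ?_
  rw [intervalIntegral.integral_comp_mul_left (fun x => Real.exp x) hb.ne', integral_exp,
    smul_eq_mul, inv_mul_eq_div]
  gcongr
  simp

/-- Hölder's inequality for the square of an `L^(2β)` kernel slice against `exp (q⁻¹ * b * s)`,
where `q` is the exponent conjugate to `β`. -/
theorem lintegral_sq_mul_exp_le {β q L b t : ℝ} (hβq : β.HolderConjugate q) (hL : 0 ≤ L)
    (hb : 0 < b) (ht : 0 ≤ t) {f : ℝ → ℝ} (hf : Measurable f) (hf0 : ∀ s, 0 ≤ f s)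
    (hfL : ∫⁻ s in Ioc (0:ℝ) t, ENNReal.ofReal (f s ^ (2 * β)) ≤ ENNReal.ofReal L) :
    ∫⁻ s in Ioc (0:ℝ) t, ENNReal.ofReal (f s ^ 2 * Real.exp (b / q * s)) ≤
      ENNReal.ofReal (L ^ (1 / β) * (Real.exp (b / q * t) / b ^ (1 / q))) := by
  have hq := hβq.symm.pos
  have hβ := hβq.pos
  have hölder := ENNReal.lintegral_mul_le_Lp_mul_Lq (volume.restrict (Ioc 0 t)) hβq
    (f := fun s => ENNReal.ofReal (f s ^ 2))
    (g := fun s => ENNReal.ofReal (Real.exp (b / q * s))) (by fun_prop) (by fun_prop)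
  have hpow : ∀ s, ENNReal.ofReal (f s ^ 2) ^ β = ENNReal.ofReal (f s ^ (2 * β)) := fun s => by
    rw [ENNReal.ofReal_rpow_of_nonneg (by positivity) hβ.le, Real.rpow_mul (hf0 s), Real.rpow_two]
  have hexp : ∀ s, ENNReal.ofReal (Real.exp (b / q * s)) ^ q =
      ENNReal.ofReal (Real.exp (b * s)) := fun s => by
    rw [ENNReal.ofReal_rpow_of_nonneg (by positivity) hq.le, ← Real.exp_mul]
    congr 2
    field_simp
  simp only [Pi.mul_apply, hpow, hexp] at hölder
  simp only [ENNReal.ofReal_mul (sq_nonneg _)]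
  refine hölder.trans ?_
  rw [ENNReal.ofReal_mul (by positivity)]
  refine mul_le_mul' ?_ ?_
  · rw [← ENNReal.ofReal_rpow_of_nonneg hL (by positivity)]
    gcongr
  · have hroot : Real.exp (b / q * t) / b ^ (1 / q) = (Real.exp (b * t) / b) ^ (1 / q) := by
      rw [Real.div_rpow (by positivity) hb.le, ← Real.exp_mul]
      congr 2
      field_simp
    rw [hroot, ← ENNReal.ofReal_rpow_of_nonneg (by positivity) (by positivity)]
    gcongr
    exact lintegral_exp_mul_Ioc_le hb ht

/-- Gronwall-type lemma for Volterra integral inequalities with a kernel uniformly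
`L^(2β)`-integrable in its second variable: there is `C = C(T, L, β) > 0` such that any
bounded measurable nonnegative `v` with `v(t) ≤ A + ∫_0^t k(t,s)² v(s) ds` on `[0,T]`
satisfies `v(t) ≤ C A` on `[0,T]`. -/
theorem stmt_1 (T β L : ℝ) (hT : 0 < T) (hβ : 1 < β) (hL : 0 ≤ L) :
    ∃ C > 0, ∀ k : ℝ → ℝ → ℝ, Measurable (Function.uncurry k) → (∀ t s, 0 ≤ k t s) →
      (∀ t ∈ Icc (0:ℝ) T,
        ∫⁻ s in Ioc (0:ℝ) t, ENNReal.ofReal ((k t s) ^ (2*β)) ≤ ENNReal.ofReal L) →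
      ∀ A : ℝ, 0 ≤ A →
      ∀ v : ℝ → ℝ, Measurable v → (∀ t, 0 ≤ v t) →
      (∃ M, ∀ t ∈ Icc (0:ℝ) T, v t ≤ M) →
      (∀ t ∈ Icc (0:ℝ) T, v t ≤ A + ∫ s in (0:ℝ)..t, (k t s)^2 * v s) →
      ∀ t ∈ Icc (0:ℝ) T, v t ≤ C * A := by
  obtain ⟨q, hβq⟩ : ∃ q, β.HolderConjugate q := ⟨_, Real.HolderConjugate.conjExponent hβ⟩
  have hq := hβq.symm.pos
  set l : ℝ := L ^ (1 / β) with hl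
  have hl0 : 0 ≤ l := by positivity
  set b : ℝ := (2 * l + 1) ^ q with hb
  have hb0 : 0 < b := by positivity
  have hbq : b ^ (1 / q) = 2 * l + 1 := by
    rw [hb, ← Real.rpow_mul (by positivity), mul_one_div_cancel hq.ne', Real.rpow_one]
  refine ⟨2 * Real.exp (b / q * T), by positivity, ?_⟩
  intro k hk hk0 hkL A hA v hv hv0 ⟨M, hM⟩ hineq
  set w : ℝ → ℝ := fun t => v t * Real.exp (-(b / q * t)) with hw
  have hvw : ∀ t, v t = w t * Real.exp (b / q * t) := fun t => by
    rw [hw, mul_assoc, ← Real.exp_add, neg_add_cancel, Real.exp_zero, mul_one]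
  set S : ℝ := sSup (w '' Icc 0 T) with hS
  have hbdd : BddAbove (w '' Icc 0 T) := by
    refine ⟨M, ?_⟩
    rintro _ ⟨t, ht, rfl⟩
    refine (mul_le_of_le_one_right (hv0 t) ?_).trans (hM t ht)
    have := ht.1
    exact Real.exp_le_one_iff.2 (neg_nonpos.2 (by positivity))
  have hwS : ∀ t ∈ Icc 0 T, w t ≤ S := fun t ht => le_csSup hbdd (mem_image_of_mem w ht)
  have hS0 : 0 ≤ S :=
    (mul_nonneg (hv0 0) (Real.exp_pos _).le).trans (hwS 0 ⟨le_rfl, hT.le⟩)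
  have hcontract : ∀ t ∈ Icc 0 T, w t ≤ A + S / 2 := by
    intro t ht
    have hkt : Measurable (k t) := hk.comp measurable_prodMk_left
    have hint : ∫ s in (0:ℝ)..t, (k t s)^2 * v s ≤ S / 2 * Real.exp (b / q * t) := by
      rw [intervalIntegral.integral_of_le ht.1, integral_eq_lintegral_of_nonneg_ae
        (ae_of_all _ fun s => mul_nonneg (sq_nonneg _) (hv0 s))
        (by fun_prop)]
      refine ENNReal.toReal_le_of_le_ofReal (by positivity) ?_
      calc ∫⁻ s in Ioc 0 t, ENNReal.ofReal ((k t s)^2 * v s)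
          ≤ ∫⁻ s in Ioc 0 t, ENNReal.ofReal S *
              ENNReal.ofReal ((k t s)^2 * Real.exp (b / q * s)) := by
            refine setLIntegral_mono' measurableSet_Ioc fun s hs => ?_
            rw [← ENNReal.ofReal_mul hS0, hvw s, mul_left_comm]
            refine ENNReal.ofReal_le_ofReal ?_
            gcongr
            exact hwS s ⟨hs.1.le, hs.2.trans ht.2⟩
        _ = ENNReal.ofReal S *
              ∫⁻ s in Ioc 0 t, ENNReal.ofReal ((k t s)^2 * Real.exp (b / q * s)) :=
            lintegral_const_mul _ (by fun_prop)
        _ ≤ ENNReal.ofReal S * ENNReal.ofReal (l * (Real.exp (b / q * t) / b ^ (1 / q))) := by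
            gcongr
            exact lintegral_sq_mul_exp_le hβq hL hb0 ht.1 hkt (hk0 t) (hkL t ht)
        _ ≤ ENNReal.ofReal (S / 2 * Real.exp (b / q * t)) := by
            rw [← ENNReal.ofReal_mul hS0, hbq]
            refine ENNReal.ofReal_le_ofReal ?_
            have hhalf : l / (2 * l + 1) ≤ 1 / 2 := by
              rw [div_le_div_iff₀ (by positivity) (by positivity)]
              linarith
            calc S * (l * (Real.exp (b / q * t) / (2 * l + 1)))
                = S * Real.exp (b / q * t) * (l / (2 * l + 1)) := by ring
              _ ≤ S * Real.exp (b / q * t) * (1 / 2) := by gcongr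
              _ = S / 2 * Real.exp (b / q * t) := by ring
    have hone : 1 ≤ Real.exp (b / q * t) := by
      have := ht.1
      exact Real.one_le_exp (by positivity)
    refine le_of_mul_le_mul_right ?_ (Real.exp_pos (b / q * t))
    rw [← hvw t]
    linarith [hineq t ht, le_mul_of_one_le_right hA hone]
  have hSA : S ≤ 2 * A := by
    have : S ≤ A + S / 2 := by
      refine csSup_le ⟨w 0, mem_image_of_mem w ⟨le_rfl, hT.le⟩⟩ ?_
      rintro _ ⟨t, ht, rfl⟩
      exact hcontract t ht
    linarith
  intro t ht
  calc v t = w t * Real.exp (b / q * t) := hvw t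
    _ ≤ 2 * A * Real.exp (b / q * T) := by
        gcongr
        · exact (hwS t ht).trans hSA
        · exact ht.2
    _ = 2 * Real.exp (b / q * T) * A := by ring
end

section
/- Let $T>0$ and $L\ge 0$, let $k:[0,T]\times[0,T]\to[0,\infty)$ be measurable with $\int_0^t k(t,s)^{2}\,ds \le L$ for every $t\in[0,T]$, and let $b:[0,T]\times[0,T]\times\mathbb{R}\to\mathbb{R}$ be measurable with $|b(t,s,x)-b(t,s,y)| \le k(t,s)\,|x-y|$ for all $t,s\in[0,T]$ and $x,y\in\mathbb{R}$. If $x_0\in\mathbb{R}$ and $x,y:[0,T]\to\mathbb{R}$ are bounded measurable functions satisfying $x_t = x_0 + \int_0^t b(t,s,x_s)\,ds$ and $y_t = x_0 + \int_0^t b(t,s,y_s)\,ds$ for all $t\in[0,T]$, then $x_t = y_t$ for all $t\in[0,T]$. -/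
open MeasureTheory Set

/-- Iterated Grönwall bound: an integrable `f`, bounded above by `M`, with
`f t ≤ L ∫_0^t f` is dominated by the Taylor remainders `M (L t)^n / n!`. -/
lemma le_mul_pow_div_factorial_of_le_integral {T L M : ℝ} (hL : 0 ≤ L) {f : ℝ → ℝ}
    (hf_int : IntegrableOn f (Icc 0 T)) (hf_bdd : ∀ t ∈ Icc 0 T, f t ≤ M)
    (hf : ∀ t ∈ Icc 0 T, f t ≤ L * ∫ s in (0 : ℝ)..t, f s) (n : ℕ) :
    ∀ t ∈ Icc 0 T, f t ≤ M * ((L * t) ^ n / n.factorial) := by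
  induction n with
  | zero => simpa using hf_bdd
  | succ n ih =>
    intro t ht
    have hmono : ∫ s in (0 : ℝ)..t, f s ≤
        ∫ s in (0 : ℝ)..t, M * ((L * s) ^ n / n.factorial) := by
      refine intervalIntegral.integral_mono_on ht.1 ?_
        (Continuous.intervalIntegrable (by fun_prop) _ _)
        fun s hs => ih s ⟨hs.1, hs.2.trans ht.2⟩
      exact (intervalIntegrable_iff_integrableOn_Icc_of_le ht.1).2
        (hf_int.mono_set (Icc_subset_Icc_right ht.2))
    refine (hf t ht).trans ((mul_le_mul_of_nonneg_left hmono hL).trans_eq ?_)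
    have hpow : (fun s : ℝ => M * ((L * s) ^ n / n.factorial)) =
        fun s => (M * L ^ n / n.factorial) * s ^ n := by
      ext s; ring
    rw [hpow, intervalIntegral.integral_const_mul, integral_pow, Nat.factorial_succ]
    push_cast
    rw [zero_pow n.succ_ne_zero]
    field_simp
    ring

/-- Integral Grönwall lemma: an integrable `f`, bounded above, with `f t ≤ L ∫_0^t f` is
nonpositive. -/
lemma nonpos_of_le_integral {T L M : ℝ} (hL : 0 ≤ L) {f : ℝ → ℝ}
    (hf_int : IntegrableOn f (Icc 0 T)) (hf_bdd : ∀ t ∈ Icc 0 T, f t ≤ M)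
    (hf : ∀ t ∈ Icc 0 T, f t ≤ L * ∫ s in (0 : ℝ)..t, f s) :
    ∀ t ∈ Icc 0 T, f t ≤ 0 := by
  intro t ht
  have hlim := (FloorSemiring.tendsto_pow_div_factorial_atTop (L * t)).const_mul M
  rw [mul_zero] at hlim
  exact ge_of_tendsto' hlim fun n =>
    le_mul_pow_div_factorial_of_le_integral hL hf_int hf_bdd hf n t ht

/-- Cauchy–Schwarz for a function dominated by a product `g h`, with `∫ g² ≤ L`. -/
lemma sq_integral_le_of_abs_le_mul {α : Type*} [MeasurableSpace α] {μ : Measure α} {L : ℝ}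
    (hL : 0 < L) {u g h : α → ℝ} (hu : Integrable u μ) (hg : Integrable (fun a => g a ^ 2) μ)
    (hh : Integrable (fun a => h a ^ 2) μ) (hgL : ∫ a, g a ^ 2 ∂μ ≤ L)
    (hugh : ∀ᵐ a ∂μ, |u a| ≤ g a * h a) :
    (∫ a, u a ∂μ) ^ 2 ≤ L * ∫ a, h a ^ 2 ∂μ := by
  set I := ∫ a, |u a| ∂μ with hI
  have hI0 : 0 ≤ I := integral_nonneg fun a => abs_nonneg _
  have hle : ∫ a, 2 * (I / L) * |u a| ∂μ ≤ ∫ a, ((I / L) ^ 2 * g a ^ 2 + h a ^ 2) ∂μ := by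
    refine integral_mono_ae (hu.abs.const_mul _) ((hg.const_mul _).add hh) ?_
    filter_upwards [hugh] with a ha
    have hmul := mul_le_mul_of_nonneg_left ha (by positivity : 0 ≤ 2 * (I / L))
    nlinarith [sq_nonneg (I / L * g a - h a)]
  rw [integral_const_mul, integral_add (hg.const_mul _) hh, integral_const_mul, ← hI] at hle
  have hgL' := mul_le_mul_of_nonneg_left hgL (sq_nonneg (I / L))
  have hI2 : I ^ 2 ≤ L * ∫ a, h a ^ 2 ∂μ := by
    have hdiv : (I / L) ^ 2 * L ≤ ∫ a, h a ^ 2 ∂μ := by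
      have e' : 2 * (I / L) * I = 2 * ((I / L) ^ 2 * L) := by field_simp
      linarith
    calc I ^ 2 = L * ((I / L) ^ 2 * L) := by field_simp
      _ ≤ _ := mul_le_mul_of_nonneg_left hdiv hL.le
  refine le_trans ?_ hI2
  exact sq_le_sq' (abs_le.1 (abs_integral_le_integral_abs)).1
    (abs_le.1 (abs_integral_le_integral_abs)).2

/-- Uniqueness of bounded solutions for the deterministic Volterra equation
`x_t = x₀ + ∫_0^t b(t,s,x_s) ds`, when `b` is Lipschitz in its third variable with a
kernel `k` uniformly square integrable in its second variable. -/
theorem stmt_2 (T L : ℝ) (hT : 0 < T) (hL : 0 ≤ L)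
    (k : ℝ → ℝ → ℝ) (hk_meas : Measurable (Function.uncurry k))
    (hk_nonneg : ∀ t s, 0 ≤ k t s)
    (hk_int : ∀ t ∈ Icc (0:ℝ) T,
      ∫⁻ s in Ioc (0:ℝ) t, ENNReal.ofReal ((k t s) ^ 2) ≤ ENNReal.ofReal L)
    (b : ℝ → ℝ → ℝ → ℝ)
    (hb_meas : Measurable fun q : ℝ × ℝ × ℝ => b q.1 q.2.1 q.2.2)
    (hb_lip : ∀ t ∈ Icc (0:ℝ) T, ∀ s ∈ Icc (0:ℝ) T, ∀ x y : ℝ,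
      |b t s x - b t s y| ≤ k t s * |x - y|)
    (x₀ : ℝ) (x y : ℝ → ℝ) (hx_meas : Measurable x) (hy_meas : Measurable y)
    (hx_bdd : ∃ M, ∀ t ∈ Icc (0:ℝ) T, |x t| ≤ M)
    (hy_bdd : ∃ M, ∀ t ∈ Icc (0:ℝ) T, |y t| ≤ M)
    (hx_int : ∀ t ∈ Icc (0:ℝ) T, IntegrableOn (fun s => b t s (x s)) (Ioc 0 t))
    (hy_int : ∀ t ∈ Icc (0:ℝ) T, IntegrableOn (fun s => b t s (y s)) (Ioc 0 t))
    (hx_eq : ∀ t ∈ Icc (0:ℝ) T, x t = x₀ + ∫ s in (0:ℝ)..t, b t s (x s))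
    (hy_eq : ∀ t ∈ Icc (0:ℝ) T, y t = x₀ + ∫ s in (0:ℝ)..t, b t s (y s)) :
    ∀ t ∈ Icc (0:ℝ) T, x t = y t := by
  obtain ⟨M, hM⟩ := hx_bdd
  obtain ⟨N, hN⟩ := hy_bdd
  have hbdd : ∀ t ∈ Icc (0:ℝ) T, (x t - y t) ^ 2 ≤ (M + N) ^ 2 := fun t ht =>
    sq_le_sq.2 <| (abs_sub _ _).trans <|
      (add_le_add (hM t ht) (hN t ht)).trans (le_abs_self _)
  have hint : IntegrableOn (fun t => (x t - y t) ^ 2) (Icc 0 T) := by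
    refine Measure.integrableOn_of_bounded (M := (M + N) ^ 2) measure_Icc_lt_top.ne
      ((hx_meas.sub hy_meas).pow_const 2).aestronglyMeasurable ?_
    filter_upwards [ae_restrict_mem measurableSet_Icc] with t ht
    rw [Real.norm_of_nonneg (sq_nonneg _)]
    exact hbdd t ht
  have hvolterra : ∀ t ∈ Icc (0:ℝ) T,
      (x t - y t) ^ 2 ≤ (L + 1) * ∫ s in (0:ℝ)..t, (x s - y s) ^ 2 := by
    intro t ht
    have hk2_meas : Measurable fun s => k t s ^ 2 :=
      (hk_meas.comp measurable_prodMk_left).pow_const 2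
    have hk2_int : IntegrableOn (fun s => k t s ^ 2) (Ioc 0 t) := by
      refine ⟨hk2_meas.aestronglyMeasurable, ?_⟩
      rw [hasFiniteIntegral_iff_ofReal (Filter.Eventually.of_forall fun s => sq_nonneg _)]
      exact (hk_int t ht).trans_lt ENNReal.ofReal_lt_top
    have hk2_le : ∫ s in Ioc 0 t, k t s ^ 2 ≤ L + 1 := by
      rw [integral_eq_lintegral_of_nonneg_ae (Filter.Eventually.of_forall fun s => sq_nonneg _)
        hk2_meas.aestronglyMeasurable]
      exact (ENNReal.toReal_le_of_le_ofReal hL (hk_int t ht)).trans (by linarith)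
    have hsub : x t - y t = ∫ s in Ioc 0 t, (b t s (x s) - b t s (y s)) := by
      rw [integral_sub (hx_int t ht) (hy_int t ht), hx_eq t ht, hy_eq t ht,
        intervalIntegral.integral_of_le ht.1, intervalIntegral.integral_of_le ht.1]
      ring
    have hincl : Ioc 0 t ⊆ Icc 0 T := Ioc_subset_Icc_self.trans (Icc_subset_Icc_right ht.2)
    have hcs := sq_integral_le_of_abs_le_mul (by linarith : 0 < L + 1)
      ((hx_int t ht).sub (hy_int t ht)) hk2_int (h := fun s => |x s - y s|)
      (by simpa only [sq_abs] using (hint.mono_set hincl).integrable) hk2_le (by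
        filter_upwards [ae_restrict_mem measurableSet_Ioc] with s hs
        exact hb_lip t ht s (hincl hs) _ _)
    rw [hsub, intervalIntegral.integral_of_le ht.1]
    simpa only [sq_abs, Pi.sub_apply] using hcs
  intro t ht
  have hzero := nonpos_of_le_integral (by linarith) hint hbdd hvolterra t ht
  exact sub_eq_zero.1 (pow_eq_zero_iff two_ne_zero |>.1 (le_antisymm hzero (sq_nonneg _)))
end

section
/- Let $T>0$ and $L\ge 0$, let $k:[0,T]\times[0,T]\to[0,\infty)$ be measurable with $\int_0^t k(t,s)^{2}\,ds \le L$ for every $t\in[0,T]$, and let $b:[0,T]\times[0,T]\times\mathbb{R}\to\mathbb{R}$ be measurable with $|b(t,s,x)| \le k(t,s)\,(1+|x|)$ for all $t,s\in[0,T]$ and $x\in\mathbb{R}$. Then there exists a constant $C>0$, depending only on $|x_0|$, $L$ and $T$, such that every bounded measurable function $x:[0,T]\to\mathbb{R}$ satisfying $x_t = x_0 + \int_0^t b(t,s,x_s)\,ds$ for all $t\in[0,T]$ obeys $\sup_{t\in[0,T]}|x_t| \le C$. -/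
open MeasureTheory Set

/-- If the Lebesgue integral of `κ ^ 2` over `S` is at most `L`, then `κ ^ 2` is integrable on `S`
and its Bochner integral is at most `L`. -/
lemma integrableOn_sq_and_setIntegral_sq_le {κ : ℝ → ℝ} (hκ : Measurable κ) {S : Set ℝ} {L : ℝ}
    (hL : 0 ≤ L) (h : ∫⁻ s in S, ENNReal.ofReal (κ s ^ 2) ≤ ENNReal.ofReal L) :
    IntegrableOn (fun s => κ s ^ 2) S ∧ ∫ s in S, κ s ^ 2 ≤ L := by
  have hm : Measurable fun s => κ s ^ 2 := hκ.pow_const 2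
  have hnn : 0 ≤ᵐ[volume.restrict S] fun s => κ s ^ 2 := ae_of_all _ fun s => sq_nonneg _
  refine ⟨⟨hm.aestronglyMeasurable, ?_⟩, ?_⟩
  · rw [hasFiniteIntegral_iff_ofReal hnn]
    exact h.trans_lt ENNReal.ofReal_lt_top
  · rw [integral_eq_lintegral_of_nonneg_ae hnn hm.aestronglyMeasurable]
    exact ENNReal.toReal_le_of_le_ofReal hL h

/-- The integral of `exp (a * (s - t))` over `[0, t]` is at most `1 / a`. -/
lemma integral_exp_mul_sub_le {a : ℝ} (ha : 0 < a) (t : ℝ) :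
    ∫ s in (0:ℝ)..t, Real.exp (a * (s - t)) ≤ 1 / a := by
  have hd : ∀ s ∈ uIcc (0:ℝ) t,
      HasDerivAt (fun s => Real.exp (a * (s - t)) / a) (Real.exp (a * (s - t))) s := by
    intro s _
    have h := ((((hasDerivAt_id s).sub_const t).const_mul a).exp).div_const a
    simpa [ha.ne'] using h
  rw [intervalIntegral.integral_eq_sub_of_hasDerivAt hd
    (Continuous.intervalIntegrable (by fun_prop) _ _)]
  have : 0 ≤ Real.exp (a * (0 - t)) / a := by positivity
  simp only [sub_self, mul_zero, Real.exp_zero]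
  linarith

/-- A function dominated by `κ s * (N * exp (μ * s))`, where `κ` has squared `L²` norm at most `L`
on `(0, t]` and `μ = 2 * (L + 1)`, has integral at most `N / 2 * exp (μ * t)`. -/
lemma abs_integral_le_half_mul_exp {f κ : ℝ → ℝ} (hκ : Measurable κ) {L N t : ℝ}
    (hL : 0 ≤ L) (hN : 0 ≤ N) (ht : 0 ≤ t)
    (h : ∫⁻ s in Ioc (0:ℝ) t, ENNReal.ofReal (κ s ^ 2) ≤ ENNReal.ofReal L)
    (hf : ∀ s ∈ Ioc (0:ℝ) t, |f s| ≤ κ s * (N * Real.exp (2 * (L + 1) * s))) :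
    |∫ s in (0:ℝ)..t, f s| ≤ N / 2 * Real.exp (2 * (L + 1) * t) := by
  obtain ⟨hint, hle⟩ := integrableOn_sq_and_setIntegral_sq_le hκ hL h
  set μ := 2 * (L + 1) with hμ
  have hμ0 : 0 < μ := by positivity
  have hint' : IntervalIntegrable (fun s => κ s ^ 2) volume 0 t :=
    (intervalIntegrable_iff_integrableOn_Ioc_of_le ht).2 hint
  have hexp : IntervalIntegrable (fun s => Real.exp (2 * μ * (s - t))) volume 0 t :=
    Continuous.intervalIntegrable (by fun_prop) _ _
  have hsum : IntervalIntegrable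
      (fun s => κ s ^ 2 / (2 * μ) + μ / 2 * Real.exp (2 * μ * (s - t))) volume 0 t :=
    (hint'.div_const _).add (hexp.const_mul _)
  have hbound : ∀ s ∈ Ioc (0:ℝ) t, ‖f s‖ ≤ N * Real.exp (μ * t) *
      (κ s ^ 2 / (2 * μ) + μ / 2 * Real.exp (2 * μ * (s - t))) := by
    intro s hs
    have e1 : Real.exp (μ * s) = Real.exp (μ * t) * Real.exp (μ * (s - t)) := by
      rw [← Real.exp_add]; ring_nf
    have e2 : Real.exp (2 * μ * (s - t)) = Real.exp (μ * (s - t)) ^ 2 := by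
      rw [← Real.exp_nat_mul]; push_cast; ring_nf
    have young : κ s * Real.exp (μ * (s - t)) ≤
        κ s ^ 2 / (2 * μ) + μ / 2 * Real.exp (2 * μ * (s - t)) := by
      rw [e2, ← sub_nonneg]
      have : κ s ^ 2 / (2 * μ) + μ / 2 * Real.exp (μ * (s - t)) ^ 2
          - κ s * Real.exp (μ * (s - t))
          = (κ s - μ * Real.exp (μ * (s - t))) ^ 2 / (2 * μ) := by
        field_simp
        ring
      rw [this]
      positivity
    calc ‖f s‖ ≤ κ s * (N * Real.exp (μ * s)) := hf s hs
      _ = N * Real.exp (μ * t) * (κ s * Real.exp (μ * (s - t))) := by rw [e1]; ring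
      _ ≤ _ := by gcongr
  calc |∫ s in (0:ℝ)..t, f s|
      ≤ ∫ s in (0:ℝ)..t, N * Real.exp (μ * t) *
          (κ s ^ 2 / (2 * μ) + μ / 2 * Real.exp (2 * μ * (s - t))) :=
        intervalIntegral.norm_integral_le_of_norm_le ht (ae_of_all _ hbound) (hsum.const_mul _)
    _ = N * Real.exp (μ * t) * ((∫ s in (0:ℝ)..t, κ s ^ 2) / (2 * μ) +
          μ / 2 * ∫ s in (0:ℝ)..t, Real.exp (2 * μ * (s - t))) := by
        rw [intervalIntegral.integral_const_mul,
          intervalIntegral.integral_add (hint'.div_const _) (hexp.const_mul _),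
          intervalIntegral.integral_div, intervalIntegral.integral_const_mul]
    _ ≤ N * Real.exp (μ * t) * (L / (2 * μ) + μ / 2 * (1 / (2 * μ))) := by
        rw [intervalIntegral.integral_of_le ht]
        gcongr
        exact integral_exp_mul_sub_le (by positivity) t
    _ ≤ N * Real.exp (μ * t) * (1 / 2) := by
        gcongr
        have h1 : L / (2 * μ) ≤ 1 / 4 := by
          rw [div_le_div_iff₀ (by positivity) (by norm_num)]
          linarith
        have h2 : μ / 2 * (1 / (2 * μ)) = 1 / 4 := by
          field_simp
          norm_num
        linarith
    _ = N / 2 * Real.exp (μ * t) := by ring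

/-- A priori bound for bounded solutions of the deterministic Volterra equation
`x_t = x₀ + ∫_0^t b(t,s,x_s) ds`, under linear growth of `b` with a kernel `k`
uniformly square integrable in its second variable: there is `C = C(|x₀|, L, T) > 0` with
`sup_{t ∈ [0,T]} |x_t| ≤ C`. -/
theorem stmt_3 (T L x₀ : ℝ) (hT : 0 < T) (hL : 0 ≤ L) :
    ∃ C > 0, ∀ k : ℝ → ℝ → ℝ, Measurable (Function.uncurry k) → (∀ t s, 0 ≤ k t s) →
      (∀ t ∈ Icc (0:ℝ) T,
        ∫⁻ s in Ioc (0:ℝ) t, ENNReal.ofReal ((k t s) ^ 2) ≤ ENNReal.ofReal L) →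
      ∀ b : ℝ → ℝ → ℝ → ℝ, (Measurable fun q : ℝ × ℝ × ℝ => b q.1 q.2.1 q.2.2) →
      (∀ t ∈ Icc (0:ℝ) T, ∀ s ∈ Icc (0:ℝ) T, ∀ z : ℝ, |b t s z| ≤ k t s * (1 + |z|)) →
      ∀ x : ℝ → ℝ, Measurable x → (∃ M, ∀ t ∈ Icc (0:ℝ) T, |x t| ≤ M) →
      (∀ t ∈ Icc (0:ℝ) T, x t = x₀ + ∫ s in (0:ℝ)..t, b t s (x s)) →
      ∀ t ∈ Icc (0:ℝ) T, |x t| ≤ C := by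
  refine ⟨2 * (1 + |x₀|) * Real.exp (2 * (L + 1) * T), by positivity, ?_⟩
  intro k hk hk0 hkL b _ hbk x _ ⟨M, hM⟩ hx t ht
  set μ := 2 * (L + 1) with hμ
  have hμ0 : 0 < μ := by positivity
  set g : ℝ → ℝ := fun s => (1 + |x s|) * Real.exp (-(μ * s)) with hg
  have hgx : ∀ s, 1 + |x s| = g s * Real.exp (μ * s) := by
    intro s
    rw [hg, mul_assoc, ← Real.exp_add]
    simp
  have hbdd : BddAbove (g '' Icc 0 T) := by
    refine ⟨1 + M, ?_⟩
    rintro _ ⟨s, hs, rfl⟩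
    have h1 : Real.exp (-(μ * s)) ≤ 1 :=
      Real.exp_le_one_iff.2 (neg_nonpos.2 (mul_nonneg hμ0.le hs.1))
    calc g s ≤ (1 + |x s|) * 1 := by simp only [hg]; gcongr
      _ ≤ 1 + M := by linarith [hM s hs]
  set N := sSup (g '' Icc 0 T) with hN
  have hgN : ∀ s ∈ Icc (0:ℝ) T, g s ≤ N := fun s hs => le_csSup hbdd (mem_image_of_mem g hs)
  have hN0 : 0 ≤ N := le_trans (by positivity) (hgN t ht)
  have hstep : ∀ r ∈ Icc (0:ℝ) T, g r ≤ 1 + |x₀| + N / 2 := by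
    intro r hr
    have hI := abs_integral_le_half_mul_exp (f := fun s => b r s (x s)) (κ := k r)
      (hk.comp measurable_prodMk_left) hL hN0 hr.1 (hkL r hr) (by
        intro s hs
        have hsT : s ∈ Icc (0:ℝ) T := ⟨hs.1.le, hs.2.trans hr.2⟩
        refine (hbk r hr s hsT (x s)).trans (mul_le_mul_of_nonneg_left ?_ (hk0 r s))
        rw [hgx s]
        exact mul_le_mul_of_nonneg_right (hgN s hsT) (Real.exp_pos _).le)
    have hxr : |x r| ≤ |x₀| + N / 2 * Real.exp (μ * r) := by
      rw [hx r hr]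
      exact (abs_add_le _ _).trans (by gcongr)
    have he : 1 ≤ Real.exp (μ * r) := Real.one_le_exp (mul_nonneg hμ0.le hr.1)
    refine le_of_mul_le_mul_right ?_ (Real.exp_pos (μ * r))
    rw [← hgx r]
    nlinarith [abs_nonneg x₀]
  have hNle : N ≤ 1 + |x₀| + N / 2 := by
    refine csSup_le ⟨_, mem_image_of_mem g ht⟩ ?_
    rintro _ ⟨r, hr, rfl⟩
    exact hstep r hr
  calc |x t| ≤ g t * Real.exp (μ * t) := by linarith [hgx t]
    _ ≤ 2 * (1 + |x₀|) * Real.exp (μ * T) := by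
      gcongr
      · linarith [hgN t ht]
      · exact ht.2
end

section
/- For every $T>0$ and every $\alpha$ with $1 < \alpha < \dfrac{1}{2H-1}$, one has $\sup_{t\in[0,T]} \int_0^t K_H(t,s)^{2\alpha}\,ds < \infty$. -/
open MeasureTheory Set

/-- The Euler Beta function `B(x,y) = Γ(x)Γ(y)/Γ(x+y)`. -/
noncomputable def eulerBeta (x y : ℝ) : ℝ := Real.Gamma x * Real.Gamma y / Real.Gamma (x + y)

/-- The normalizing constant `c_H = √(H(2H-1)/B(2-2H, H-1/2))`. -/
noncomputable def cH (H : ℝ) : ℝ :=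
  Real.sqrt (H * (2*H - 1) / eulerBeta (2 - 2*H) (H - 1/2))

/-- The fractional Brownian motion kernel:
`K_H(t,s) = c_H s^(1/2-H) ∫_s^t (u-s)^(H-3/2) u^(H-1/2) du` for `0 < s < t`, and `0` otherwise. -/
noncomputable def KH (H : ℝ) (t s : ℝ) : ℝ :=
  if 0 < s ∧ s < t then
    cH H * s ^ ((1:ℝ)/2 - H) * ∫ u in s..t, (u - s) ^ (H - 3/2) * u ^ (H - 1/2)
  else 0

lemma KH_nonneg (H t s : ℝ) : 0 ≤ KH H t s := by
  unfold KH
  split_ifs with h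
  · refine mul_nonneg (mul_nonneg (Real.sqrt_nonneg _) (Real.rpow_nonneg h.1.le _)) ?_
    refine intervalIntegral.integral_nonneg h.2.le fun u hu => ?_
    exact mul_nonneg (Real.rpow_nonneg (sub_nonneg.2 hu.1) _)
      (Real.rpow_nonneg (h.1.le.trans hu.1) _)
  · exact le_rfl

lemma integral_sub_rpow_mul_rpow_le {H T s t : ℝ} (hH : 1 / 2 < H) (hs : 0 < s) (hst : s < t)
    (htT : t ≤ T) :
    ∫ u in s..t, (u - s) ^ (H - 3/2) * u ^ (H - 1/2) ≤
      T ^ (H - 1/2) / (H - 1/2) * T ^ (H - 1/2) := by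
  have hp : 0 < H - 1/2 := by linarith
  have hint : IntervalIntegrable (fun u : ℝ => (u - s) ^ (H - 3/2)) volume s t := by
    have h := (intervalIntegral.intervalIntegrable_rpow' (a := 0) (b := t - s)
      (r := H - 3/2) (by linarith)).comp_sub_right s
    simpa using h
  calc ∫ u in s..t, (u - s) ^ (H - 3/2) * u ^ (H - 1/2)
      ≤ ‖∫ u in s..t, (u - s) ^ (H - 3/2) * u ^ (H - 1/2)‖ := Real.le_norm_self _
    _ ≤ ∫ u in s..t, (u - s) ^ (H - 3/2) * T ^ (H - 1/2) := by
      refine intervalIntegral.norm_integral_le_of_norm_le hst.le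
        (Filter.Eventually.of_forall fun u hu => ?_) (hint.mul_const _)
      have hu0 : 0 ≤ u := hs.le.trans hu.1.le
      have hsub : 0 ≤ (u - s) ^ (H - 3/2) := Real.rpow_nonneg (sub_nonneg.2 hu.1.le) _
      rw [Real.norm_of_nonneg (mul_nonneg hsub (Real.rpow_nonneg hu0 _))]
      exact mul_le_mul_of_nonneg_left (Real.rpow_le_rpow hu0 (hu.2.trans htT) hp.le) hsub
    _ = (t - s) ^ (H - 1/2) / (H - 1/2) * T ^ (H - 1/2) := by
      rw [intervalIntegral.integral_mul_const,
        intervalIntegral.integral_comp_sub_right (fun u : ℝ => u ^ (H - 3/2)) s, sub_self,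
        integral_rpow (Or.inl (by linarith)), show H - 3/2 + 1 = H - 1/2 by ring,
        Real.zero_rpow hp.ne', sub_zero]
    _ ≤ T ^ (H - 1/2) / (H - 1/2) * T ^ (H - 1/2) := by
      have : 0 ≤ T := by linarith
      gcongr; linarith

lemma exists_KH_le_mul_rpow {H T : ℝ} (hH : 1 / 2 < H) (hT : 0 < T) :
    ∃ M : ℝ, 0 ≤ M ∧ ∀ t ≤ T, ∀ s, 0 < s → KH H t s ≤ M * s ^ (1/2 - H) := by
  have hp : 0 < H - 1/2 := by linarith
  have hc : 0 ≤ cH H := Real.sqrt_nonneg _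
  refine ⟨cH H * (T ^ (H - 1/2) / (H - 1/2) * T ^ (H - 1/2)), by positivity,
    fun t ht s hs => ?_⟩
  unfold KH
  split_ifs with h
  · rw [mul_right_comm]
    gcongr
    exact integral_sub_rpow_mul_rpow_le hH hs h.2 ht
  · positivity

/-- For every `T > 0` and `1 < α < 1/(2H-1)`, the supremum over `t ∈ [0,T]` of
`∫_0^t K_H(t,s)^(2α) ds` is finite. -/
theorem stmt_6 (H : ℝ) (hH : H ∈ Set.Ioo (1/2 : ℝ) 1) (T α : ℝ) (hT : 0 < T)
    (hα₁ : 1 < α) (hα₂ : α < 1 / (2*H - 1)) :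
    (⨆ t ∈ Set.Icc (0:ℝ) T,
      ∫⁻ s in Set.Ioc (0:ℝ) t, ENNReal.ofReal ((KH H t s) ^ (2*α))) < ⊤ := by
  obtain ⟨M, hM, hbound⟩ := exists_KH_le_mul_rpow hH.1 hT
  have hexp : -1 < (1/2 - H) * (2*α) := by
    have := (lt_div_iff₀ (by linarith [hH.1])).1 hα₂
    linarith
  have hint : IntegrableOn (fun s : ℝ => M ^ (2*α) * s ^ ((1/2 - H) * (2*α))) (Ioc 0 T) :=
    (intervalIntegrable_iff_integrableOn_Ioc_of_le hT.le).1
      ((intervalIntegral.intervalIntegrable_rpow' hexp).const_mul _)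
  refine lt_of_le_of_lt (iSup₂_le fun t ht => ?_) hint.lintegral_lt_top
  refine (setLIntegral_mono' measurableSet_Ioc fun s hs => ENNReal.ofReal_le_ofReal ?_).trans
    (lintegral_mono_set (Ioc_subset_Ioc_right ht.2))
  rw [Real.rpow_mul hs.1.le, ← Real.mul_rpow hM (Real.rpow_nonneg hs.1.le _)]
  exact Real.rpow_le_rpow (KH_nonneg H t s) (hbound t ht.2 s hs.1) (by linarith)
end

section
/- For all $0 < s \le t$ one has $\int_0^s \big(K_H(t,u) - K_H(s,u)\big)^2\,du \; + \; \int_s^t K_H(t,u)^2\,du \; = \; (t-s)^{2H}$. -/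
open MeasureTheory Set

theorem lintegral_rpow_mul_one_sub_rpow {α β : ℝ} (hα : 0 < α) (hβ : 0 < β) :
    ∫⁻ x in Ioo (0 : ℝ) 1, ENNReal.ofReal (x ^ (α - 1) * (1 - x) ^ (β - 1)) =
      ENNReal.ofReal (eulerBeta α β) := by
  have hB : 0 < eulerBeta α β := ProbabilityTheory.beta_pos hα hβ
  have h := ProbabilityTheory.lintegral_betaPDF_eq_one hα hβ
  rw [ProbabilityTheory.lintegral_betaPDF] at h
  change ∫⁻ x in Ioo (0 : ℝ) 1, ENNReal.ofReal
    (1 / eulerBeta α β * x ^ (α - 1) * (1 - x) ^ (β - 1)) = 1 at h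
  simp_rw [mul_assoc, ENNReal.ofReal_mul (one_div_pos.2 hB).le] at h
  rw [lintegral_const_mul _ (by fun_prop), one_div, ENNReal.ofReal_inv_of_pos hB] at h
  rw [ENNReal.eq_inv_of_mul_eq_one_left ((mul_comm _ _).trans h), inv_inv]

theorem lintegral_rpow_mul_sub_rpow_mul_sub_rpow {a v w : ℝ} (ha : 0 < a) (ha' : a < 1 / 2)
    (hv : 0 < v) (hvw : v < w) :
    ∫⁻ u in Ioo 0 v, ENNReal.ofReal (u ^ (-2 * a) * ((v - u) ^ (a - 1) * (w - u) ^ (a - 1))) =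
      ENNReal.ofReal (eulerBeta (1 - 2 * a) a * ((w - v) ^ (2 * a - 1) * (v * w) ^ (-a))) := by
  have hw : 0 < w := hv.trans hvw
  have hd : 0 < w - v := sub_pos.2 hvw
  set f : ℝ → ℝ := fun u => u * (w - v) / (v * (w - u)) with hf
  have hder : ∀ u ∈ Ioo 0 v,
      HasDerivWithinAt f ((w - v) * w / (v * (w - u) ^ 2)) (Ioo 0 v) u := by
    intro u hu
    have hwu : 0 < w - u := by linarith [hu.2]
    have h1 : HasDerivAt (fun u : ℝ => u * (w - v)) (1 * (w - v)) u :=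
      (hasDerivAt_id u).mul_const _
    have h2 : HasDerivAt (fun u : ℝ => v * (w - u)) (v * (0 - 1)) u :=
      ((hasDerivAt_const u w).sub (hasDerivAt_id u)).const_mul v
    have h3 := (h1.div h2 (by positivity)).hasDerivWithinAt (s := Ioo 0 v)
    refine h3.congr_deriv ?_
    field_simp
    ring
  have hinj : InjOn f (Ioo 0 v) := by
    intro x hx y hy hxy
    have hwx : 0 < w - x := by linarith [hx.2]
    have hwy : 0 < w - y := by linarith [hy.2]
    simp only [hf] at hxy
    rw [div_eq_div_iff (by positivity) (by positivity)] at hxy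
    have : (w - v) * v * w * (x - y) = 0 := by linear_combination hxy
    have h0 : (w - v) * v * w ≠ 0 := by positivity
    linarith [(mul_eq_zero.1 this).resolve_left h0]
  have himg : f '' Ioo 0 v = Ioo 0 1 := by
    ext y
    constructor
    · rintro ⟨u, hu, rfl⟩
      have hwu : 0 < w - u := by linarith [hu.2]
      refine ⟨div_pos (mul_pos hu.1 hd) (by positivity), ?_⟩
      rw [div_lt_one (by positivity)]
      nlinarith [hu.2]
    · intro hy
      have hden : 0 < w - v + y * v := add_pos hd (mul_pos hy.1 hv)
      refine ⟨y * v * w / (w - v + y * v), ⟨?_, ?_⟩, ?_⟩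
      · exact div_pos (mul_pos (mul_pos hy.1 hv) hw) hden
      · rw [div_lt_iff₀ hden]
        nlinarith [mul_pos (mul_pos hv hd) (sub_pos.2 hy.2)]
      · have : w - y * v * w / (w - v + y * v) = (w - v) * w / (w - v + y * v) := by
          have hne := hden.ne'
          field_simp
          ring
        simp only [hf]
        rw [this]
        have hne := hden.ne'
        have hne' := hd.ne'
        field_simp
  have hC : 0 < (w - v) ^ (1 - 2 * a) * (v * w) ^ a := by positivity
  have key := lintegral_rpow_mul_one_sub_rpow (α := 1 - 2 * a) (β := a) (by linarith) ha
  rw [← himg, lintegral_image_eq_lintegral_abs_deriv_mul measurableSet_Ioo hder hinj] at key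
  have hcongr : ∀ u ∈ Ioo 0 v, ENNReal.ofReal |(w - v) * w / (v * (w - u) ^ 2)| *
        ENNReal.ofReal (f u ^ (1 - 2 * a - 1) * (1 - f u) ^ (a - 1)) =
      ENNReal.ofReal ((w - v) ^ (1 - 2 * a) * (v * w) ^ a) *
        ENNReal.ofReal (u ^ (-2 * a) * ((v - u) ^ (a - 1) * (w - u) ^ (a - 1))) := by
    intro u hu
    have hu0 := hu.1
    have hvu : 0 < v - u := sub_pos.2 hu.2
    have hwu : 0 < w - u := by linarith
    rw [← ENNReal.ofReal_mul (abs_nonneg _), ← ENNReal.ofReal_mul hC.le,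
      abs_of_pos (by positivity)]
    congr 1
    have h1 : 1 - f u = w * (v - u) / (v * (w - u)) := by
      simp only [hf]
      field_simp
      ring
    rw [h1]
    simp only [hf]
    clear_value f
    generalize w - u = p at *
    generalize v - u = q at *
    generalize w - v = d at *
    rw [← Real.exp_log hd, ← Real.exp_log hw, ← Real.exp_log hv, ← Real.exp_log hwu,
      ← Real.exp_log hvu, ← Real.exp_log hu0]
    simp only [← Real.exp_add, ← Real.exp_sub, ← Real.exp_mul, ← Real.exp_nat_mul]
    congr 1
    push_cast
    ring
  rw [setLIntegral_congr_fun measurableSet_Ioo hcongr, lintegral_const_mul _ (by fun_prop)] at key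
  have hC' : (w - v) ^ (2 * a - 1) * (v * w) ^ (-a) = ((w - v) ^ (1 - 2 * a) * (v * w) ^ a)⁻¹ := by
    rw [mul_inv, ← Real.rpow_neg hd.le, ← Real.rpow_neg (by positivity)]
    congr 2
    ring
  rw [hC', mul_comm (eulerBeta _ _), ENNReal.ofReal_mul (inv_pos.2 hC).le, ← key, ← mul_assoc,
    ← ENNReal.ofReal_mul (inv_pos.2 hC).le, inv_mul_cancel₀ hC.ne', ENNReal.ofReal_one, one_mul]

theorem setLIntegral_rpow_sub_left {r s v : ℝ} (hr : 0 < r) (h : s ≤ v) :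
    ∫⁻ w in Ioc s v, ENNReal.ofReal ((v - w) ^ (r - 1)) = ENNReal.ofReal ((v - s) ^ r / r) := by
  have hi : IntervalIntegrable (fun w => (v - w) ^ (r - 1)) volume s v := by
    have := (intervalIntegral.intervalIntegrable_rpow' (a := v - s) (b := 0)
      (show -1 < r - 1 by linarith)).comp_sub_left v
    simpa using this
  rw [← ofReal_integral_eq_lintegral_ofReal
    ((intervalIntegrable_iff_integrableOn_Ioc_of_le h).1 hi)
    (ae_restrict_of_forall_mem measurableSet_Ioc fun w hw =>
      Real.rpow_nonneg (sub_nonneg.2 hw.2) _),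
    ← intervalIntegral.integral_of_le h,
    intervalIntegral.integral_comp_sub_left (fun x => x ^ (r - 1)),
    integral_rpow (Or.inl (by linarith))]
  simp [hr.ne']

theorem intervalIntegrable_sub_rpow {r v t : ℝ} (hr : 0 < r) :
    IntervalIntegrable (fun w => (w - v) ^ (r - 1)) volume v t := by
  have := (intervalIntegral.intervalIntegrable_rpow' (a := 0) (b := t - v)
    (show -1 < r - 1 by linarith)).comp_sub_right v
  simpa using this

theorem setLIntegral_rpow_sub_right {r v t : ℝ} (hr : 0 < r) (h : v ≤ t) :
    ∫⁻ w in Ioc v t, ENNReal.ofReal ((w - v) ^ (r - 1)) = ENNReal.ofReal ((t - v) ^ r / r) := by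
  rw [← ofReal_integral_eq_lintegral_ofReal
    ((intervalIntegrable_iff_integrableOn_Ioc_of_le h).1 (intervalIntegrable_sub_rpow hr))
    (ae_restrict_of_forall_mem measurableSet_Ioc fun w hw =>
      Real.rpow_nonneg (sub_nonneg.2 hw.1.le) _),
    ← intervalIntegral.integral_of_le h,
    intervalIntegral.integral_comp_sub_right (fun x => x ^ (r - 1)),
    integral_rpow (Or.inl (by linarith))]
  simp [hr.ne']

theorem lintegral_lintegral_abs_sub_rpow {r s t : ℝ} (hr : 0 < r) (hst : s ≤ t) :
    ∫⁻ v in Ioc s t, ∫⁻ w in Ioc s t, ENNReal.ofReal (|v - w| ^ (r - 1)) =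
      ENNReal.ofReal (2 * (t - s) ^ (r + 1) / (r * (r + 1))) := by
  have hinner : ∀ v ∈ Ioc s t, ∫⁻ w in Ioc s t, ENNReal.ofReal (|v - w| ^ (r - 1)) =
      ENNReal.ofReal r⁻¹ * (ENNReal.ofReal ((v - s) ^ (r + 1 - 1)) +
        ENNReal.ofReal ((t - v) ^ (r + 1 - 1))) := by
    intro v hv
    have h1 : ∀ w ∈ Ioc s v,
        ENNReal.ofReal (|v - w| ^ (r - 1)) = ENNReal.ofReal ((v - w) ^ (r - 1)) := by
      intro w hw
      rw [abs_of_nonneg (sub_nonneg.2 hw.2)]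
    have h2 : ∀ w ∈ Ioc v t,
        ENNReal.ofReal (|v - w| ^ (r - 1)) = ENNReal.ofReal ((w - v) ^ (r - 1)) := by
      intro w hw
      rw [abs_sub_comm, abs_of_nonneg (sub_nonneg.2 hw.1.le)]
    rw [← Ioc_union_Ioc_eq_Ioc hv.1.le hv.2,
      lintegral_union measurableSet_Ioc (Ioc_disjoint_Ioc_of_le le_rfl),
      setLIntegral_congr_fun measurableSet_Ioc h1, setLIntegral_congr_fun measurableSet_Ioc h2,
      setLIntegral_rpow_sub_left hr hv.1.le, setLIntegral_rpow_sub_right hr hv.2, mul_add,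
      ← ENNReal.ofReal_mul (by positivity), ← ENNReal.ofReal_mul (by positivity),
      add_sub_cancel_right, div_eq_inv_mul, div_eq_inv_mul]
  have hts : 0 ≤ t - s := sub_nonneg.2 hst
  rw [setLIntegral_congr_fun measurableSet_Ioc hinner, lintegral_const_mul _ (by fun_prop),
    lintegral_add_left (by fun_prop), setLIntegral_rpow_sub_left (by linarith) hst,
    setLIntegral_rpow_sub_right (by linarith) hst,
    ← ENNReal.ofReal_add (by positivity) (by positivity), ← ENNReal.ofReal_mul (by positivity)]
  congr 1
  field_simp
  ring

/-- The integrand `(v-u)^(H-3/2) v^(H-1/2)` of the fractional Brownian motion kernel, supported on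
`u < v` and valued in `ℝ≥0∞`. -/
noncomputable def kernelDensity (H u v : ℝ) : ENNReal :=
  if u < v then ENNReal.ofReal ((v - u) ^ (H - 3/2) * v ^ (H - 1/2)) else 0

theorem kernelDensity_of_lt {H u v : ℝ} (h : u < v) :
    kernelDensity H u v = ENNReal.ofReal ((v - u) ^ (H - 3/2) * v ^ (H - 1/2)) := if_pos h

theorem kernelDensity_of_le {H u v : ℝ} (h : v ≤ u) : kernelDensity H u v = 0 := if_neg h.not_gt

@[fun_prop]
theorem measurable_uncurry_kernelDensity (H : ℝ) :
    Measurable fun p : ℝ × ℝ => kernelDensity H p.1 p.2 :=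
  Measurable.ite (measurableSet_lt measurable_fst measurable_snd) (by fun_prop) measurable_const

@[fun_prop]
theorem Measurable.kernelDensity {α : Type*} [MeasurableSpace α] {f g : α → ℝ} (H : ℝ)
    (hf : Measurable f) (hg : Measurable g) : Measurable fun x => kernelDensity H (f x) (g x) :=
  (measurable_uncurry_kernelDensity H).comp (hf.prodMk hg)

theorem lintegral_rpow_mul_kernelDensity_mul_kernelDensity {H v w : ℝ}
    (hH : H ∈ Ioo (1/2 : ℝ) 1) (hv : 0 < v) (hw : 0 < w) (hvw : v ≠ w) :
    ∫⁻ u in Ioi 0, ENNReal.ofReal (u ^ (1 - 2 * H)) * (kernelDensity H u v * kernelDensity H u w) =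
      ENNReal.ofReal (eulerBeta (2 - 2*H) (H - 1/2)) *
        ENNReal.ofReal (|v - w| ^ (2 * H - 1 - 1)) := by
  wlog h : v < w generalizing v w
  · have := this hw hv hvw.symm (lt_of_le_of_ne (not_lt.1 h) hvw.symm)
    rw [abs_sub_comm, ← this]
    simp only [mul_comm (kernelDensity H _ v)]
  obtain ⟨h1, h2⟩ := hH
  have hB : 0 < eulerBeta (2 - 2*H) (H - 1/2) :=
    ProbabilityTheory.beta_pos (by linarith) (by linarith)
  have hd : 0 < w - v := sub_pos.2 h
  have hzero : ∀ u ∈ Ici v, ENNReal.ofReal (u ^ (1 - 2 * H)) *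
      (kernelDensity H u v * kernelDensity H u w) = 0 := by
    intro u hu
    rw [kernelDensity_of_le hu, zero_mul, mul_zero]
  have hcongr : ∀ u ∈ Ioo 0 v, ENNReal.ofReal (u ^ (1 - 2 * H)) *
      (kernelDensity H u v * kernelDensity H u w) = ENNReal.ofReal ((v * w) ^ (H - 1/2)) *
        ENNReal.ofReal (u ^ (-2 * (H - 1/2)) *
          ((v - u) ^ (H - 1/2 - 1) * (w - u) ^ (H - 1/2 - 1))) := by
    intro u hu
    have hu0 := hu.1
    have hvu : 0 < v - u := sub_pos.2 hu.2
    have hwu : 0 < w - u := by linarith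
    rw [kernelDensity_of_lt hu.2, kernelDensity_of_lt (hu.2.trans h),
      ← ENNReal.ofReal_mul (by positivity), ← ENNReal.ofReal_mul (by positivity),
      ← ENNReal.ofReal_mul (by positivity), Real.mul_rpow hv.le hw.le,
      show -2 * (H - 1/2) = 1 - 2 * H by ring, show H - 1/2 - 1 = H - 3/2 by ring]
    congr 1
    ring
  rw [← Ioo_union_Ici_eq_Ioi hv, lintegral_union measurableSet_Ici
      (disjoint_left.2 fun x hx hx' => hx.2.not_ge hx'),
    setLIntegral_eq_zero measurableSet_Ici hzero, add_zero,
    setLIntegral_congr_fun measurableSet_Ioo hcongr, lintegral_const_mul _ (by fun_prop),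
    lintegral_rpow_mul_sub_rpow_mul_sub_rpow (by linarith) (by linarith) hv h,
    ← ENNReal.ofReal_mul (by positivity), ← ENNReal.ofReal_mul hB.le, abs_sub_comm,
    abs_of_pos hd, show 1 - 2 * (H - 1/2) = 2 - 2 * H by ring,
    show 2 * (H - 1/2) - 1 = 2 * H - 1 - 1 by ring, Real.rpow_neg (by positivity)]
  congr 1
  have : (v * w) ^ (H - 1/2) ≠ 0 := by positivity
  field_simp

theorem setLIntegral_kernelDensity_of_le {H t u : ℝ} (h : t ≤ u) :
    ∫⁻ v in Ioc 0 t, kernelDensity H u v = 0 :=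
  setLIntegral_eq_zero measurableSet_Ioc fun _ hv => kernelDensity_of_le (hv.2.trans h)

theorem setLIntegral_kernelDensity_of_lt {H t u : ℝ} (hH : 1/2 < H) (hu : 0 < u) (h : u < t) :
    ∫⁻ v in Ioc 0 t, kernelDensity H u v =
      ENNReal.ofReal (∫ v in u..t, (v - u) ^ (H - 3/2) * v ^ (H - 1/2)) := by
  have hi : IntervalIntegrable (fun v => (v - u) ^ (H - 3/2) * v ^ (H - 1/2)) volume u t := by
    have := intervalIntegrable_sub_rpow (r := H - 1/2) (v := u) (t := t) (by linarith)
    rw [show H - 1/2 - 1 = H - 3/2 by ring] at this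
    exact this.mul_continuousOn
      (continuousOn_id.rpow_const fun x _ => Or.inr (by linarith))
  rw [intervalIntegral.integral_of_le h.le, ofReal_integral_eq_lintegral_ofReal
    ((intervalIntegrable_iff_integrableOn_Ioc_of_le h.le).1 hi)
    (ae_restrict_of_forall_mem measurableSet_Ioc fun v hv => mul_nonneg
      (Real.rpow_nonneg (sub_nonneg.2 hv.1.le) _) (Real.rpow_nonneg (hu.trans hv.1).le _)),
    ← Ioc_union_Ioc_eq_Ioc hu.le h.le,
    lintegral_union measurableSet_Ioc (Ioc_disjoint_Ioc_of_le le_rfl),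
    setLIntegral_kernelDensity_of_le le_rfl, zero_add]
  exact setLIntegral_congr_fun measurableSet_Ioc fun v hv => kernelDensity_of_lt hv.1

theorem setLIntegral_kernelDensity_ne_top {H t u : ℝ} (hH : 1/2 < H) (hu : 0 < u) :
    ∫⁻ v in Ioc 0 t, kernelDensity H u v ≠ ⊤ := by
  rcases lt_or_ge u t with h | h
  · rw [setLIntegral_kernelDensity_of_lt hH hu h]
    exact ENNReal.ofReal_ne_top
  · rw [setLIntegral_kernelDensity_of_le h]
    exact ENNReal.zero_ne_top

theorem KH_eq_toReal {H t u : ℝ} (hH : 1/2 < H) (hu : 0 < u) :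
    KH H t u = (ENNReal.ofReal (cH H * u ^ ((1:ℝ)/2 - H)) *
      ∫⁻ v in Ioc 0 t, kernelDensity H u v).toReal := by
  have hc : 0 ≤ cH H * u ^ ((1:ℝ)/2 - H) := mul_nonneg (Real.sqrt_nonneg _) (by positivity)
  rw [ENNReal.toReal_mul, ENNReal.toReal_ofReal hc, KH]
  rcases lt_or_ge u t with h | h
  · rw [if_pos ⟨hu, h⟩, setLIntegral_kernelDensity_of_lt hH hu h, ENNReal.toReal_ofReal]
    exact intervalIntegral.integral_nonneg h.le fun v hv => mul_nonneg
      (Real.rpow_nonneg (sub_nonneg.2 hv.1) _) (Real.rpow_nonneg (hu.le.trans hv.1) _)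
  · rw [if_neg fun h' => h'.2.not_ge h, setLIntegral_kernelDensity_of_le h]
    simp

theorem KH_sub_eq_toReal {H s t u : ℝ} (hH : 1/2 < H) (hu : 0 < u) (hs : 0 ≤ s) (hst : s ≤ t) :
    KH H t u - KH H s u = (ENNReal.ofReal (cH H * u ^ ((1:ℝ)/2 - H)) *
      ∫⁻ v in Ioc s t, kernelDensity H u v).toReal := by
  have hfin := setLIntegral_kernelDensity_ne_top (t := t) hH hu
  rw [KH_eq_toReal hH hu, KH_eq_toReal hH hu]
  rw [← Ioc_union_Ioc_eq_Ioc hs hst,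
    lintegral_union measurableSet_Ioc (Ioc_disjoint_Ioc_of_le le_rfl)] at hfin ⊢
  simp only [ENNReal.toReal_mul]
  rw [ENNReal.toReal_add (ENNReal.add_ne_top.1 hfin).1 (ENNReal.add_ne_top.1 hfin).2]
  ring

theorem measurable_mul_setLIntegral_kernelDensity (H s t : ℝ) :
    Measurable fun u => ENNReal.ofReal (cH H * u ^ ((1:ℝ)/2 - H)) *
      ∫⁻ v in Ioc s t, kernelDensity H u v :=
  Measurable.mul (by fun_prop) (measurable_uncurry_kernelDensity H).lintegral_prod_right'

theorem lintegral_sq_mul_setLIntegral_kernelDensity {H s t : ℝ} (hH : H ∈ Ioo (1/2 : ℝ) 1)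
    (hs : 0 ≤ s) (hst : s ≤ t) :
    ∫⁻ u in Ioi 0, (ENNReal.ofReal (cH H * u ^ ((1:ℝ)/2 - H)) *
      ∫⁻ v in Ioc s t, kernelDensity H u v) ^ 2 = ENNReal.ofReal ((t - s) ^ (2 * H)) := by
  obtain ⟨h1, h2⟩ := id hH
  have hB : 0 < eulerBeta (2 - 2*H) (H - 1/2) :=
    ProbabilityTheory.beta_pos (by linarith) (by linarith)
  have hexpand : ∀ u ∈ Ioi (0 : ℝ), (ENNReal.ofReal (cH H * u ^ ((1:ℝ)/2 - H)) *
      ∫⁻ v in Ioc s t, kernelDensity H u v) ^ 2 = ENNReal.ofReal (cH H ^ 2) *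
        ∫⁻ v in Ioc s t, ∫⁻ w in Ioc s t,
          ENNReal.ofReal (u ^ (1 - 2 * H)) * (kernelDensity H u v * kernelDensity H u w) := by
    intro u hu
    have hu' : 0 < u := hu
    have hc : 0 ≤ cH H * u ^ ((1:ℝ)/2 - H) := mul_nonneg (Real.sqrt_nonneg _) (by positivity)
    have hpow : (cH H * u ^ ((1:ℝ)/2 - H)) ^ 2 = cH H ^ 2 * u ^ (1 - 2 * H) := by
      rw [mul_pow, ← Real.rpow_mul_natCast hu'.le]
      congr 2
      push_cast
      ring
    simp only [lintegral_const_mul' _ _ ENNReal.ofReal_ne_top]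
    rw [lintegral_lintegral_mul (by fun_prop) (by fun_prop), mul_pow,
      ← ENNReal.ofReal_pow hc, hpow,
      ENNReal.ofReal_mul (sq_nonneg _), mul_assoc, ← sq]
  have hmeas : Measurable fun p : (ℝ × ℝ) × ℝ => ENNReal.ofReal (p.1.1 ^ (1 - 2 * H)) *
      (kernelDensity H p.1.1 p.1.2 * kernelDensity H p.1.1 p.2) := by fun_prop
  have hinner : ∀ v ∈ Ioc s t, ∫⁻ u in Ioi 0, ∫⁻ w in Ioc s t,
      ENNReal.ofReal (u ^ (1 - 2 * H)) * (kernelDensity H u v * kernelDensity H u w) =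
        ENNReal.ofReal (eulerBeta (2 - 2*H) (H - 1/2)) *
          ∫⁻ w in Ioc s t, ENNReal.ofReal (|v - w| ^ (2 * H - 1 - 1)) := by
    intro v hv
    rw [lintegral_lintegral_swap (by fun_prop), ← lintegral_const_mul' _ _ ENNReal.ofReal_ne_top]
    refine setLIntegral_congr_fun_ae measurableSet_Ioc ?_
    filter_upwards [compl_mem_ae_iff.2 (measure_singleton (μ := volume) v)] with w hwv hw
    exact lintegral_rpow_mul_kernelDensity_mul_kernelDensity hH (hs.trans_lt hv.1)
      (hs.trans_lt hw.1) (Ne.symm hwv)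
  rw [setLIntegral_congr_fun measurableSet_Ioi hexpand,
    lintegral_const_mul' _ _ ENNReal.ofReal_ne_top,
    lintegral_lintegral_swap (hmeas.lintegral_prod_right').aemeasurable,
    setLIntegral_congr_fun measurableSet_Ioc hinner,
    lintegral_const_mul' _ _ ENNReal.ofReal_ne_top,
    lintegral_lintegral_abs_sub_rpow (by linarith) hst, ← ENNReal.ofReal_mul hB.le,
    ← ENNReal.ofReal_mul (sq_nonneg _), cH, Real.sq_sqrt
      (div_nonneg (mul_nonneg (by linarith) (by linarith)) hB.le), sub_add_cancel]
  congr 1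
  have hH0 : H ≠ 0 := by linarith
  have hH1 : H * 2 - 1 ≠ 0 := by linarith
  have hB' := hB.ne'
  generalize eulerBeta (2 - 2*H) (H - 1/2) = b at *
  rw [mul_comm 2 H]
  field_simp

/-- Itô-isometry identity for increments: for `0 < s ≤ t`,
`∫_0^s (K_H(t,u) - K_H(s,u))² du + ∫_s^t K_H(t,u)² du = (t-s)^(2H)`. -/
theorem stmt_8 (H : ℝ) (hH : H ∈ Set.Ioo (1/2 : ℝ) 1) (s t : ℝ) (hs : 0 < s) (hst : s ≤ t) :
    (∫ u in (0:ℝ)..s, (KH H t u - KH H s u)^2) + ∫ u in s..t, (KH H t u)^2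
      = (t - s) ^ (2*H) := by
  have hH1 := hH.1
  set G : ℝ → ENNReal := fun u => ENNReal.ofReal (cH H * u ^ ((1:ℝ)/2 - H)) *
    ∫⁻ v in Ioc s t, kernelDensity H u v with hG
  have hGm : Measurable G := measurable_mul_setLIntegral_kernelDensity H s t
  have ht : 0 ≤ t := hs.le.trans hst
  have hGt : ∀ u ∈ Ioi t, G u ^ 2 = 0 := by
    intro u hu
    simp only [hG]
    rw [setLIntegral_eq_zero measurableSet_Ioc fun v hv =>
      kernelDensity_of_le (hv.2.trans (le_of_lt hu))]
    simp
  have hlin : ∫⁻ u in Ioc 0 t, G u ^ 2 = ENNReal.ofReal ((t - s) ^ (2 * H)) := by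
    rw [← lintegral_sq_mul_setLIntegral_kernelDensity hH hs.le hst, ← Ioc_union_Ioi_eq_Ioi ht,
      lintegral_union measurableSet_Ioi (Ioc_disjoint_Ioi le_rfl),
      setLIntegral_eq_zero measurableSet_Ioi hGt, add_zero]
  have hfin : ∫⁻ u in Ioc 0 t, G u ^ 2 ≠ ⊤ := hlin ▸ ENNReal.ofReal_ne_top
  have hGm2 : AEMeasurable (fun u => G u ^ 2) (volume.restrict (Ioc 0 t)) :=
    (hGm.pow_const 2).aemeasurable
  have hint : IntervalIntegrable (fun u => (G u ^ 2).toReal) volume 0 t :=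
    (intervalIntegrable_iff_integrableOn_Ioc_of_le ht).2
      (integrable_toReal_of_lintegral_ne_top hGm2 hfin)
  have hleft : ∫ u in (0:ℝ)..s, (KH H t u - KH H s u)^2 = ∫ u in (0:ℝ)..s, (G u ^ 2).toReal := by
    refine intervalIntegral.integral_congr_ae (Filter.Eventually.of_forall fun u hu => ?_)
    rw [uIoc_of_le hs.le] at hu
    rw [KH_sub_eq_toReal hH1 hu.1 hs.le hst, ENNReal.toReal_pow]
  have hright : ∫ u in s..t, (KH H t u)^2 = ∫ u in s..t, (G u ^ 2).toReal := by
    refine intervalIntegral.integral_congr_ae (Filter.Eventually.of_forall fun u hu => ?_)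
    rw [uIoc_of_le hst] at hu
    have hzero : KH H s u = 0 := if_neg fun h => h.2.not_gt hu.1
    rw [← sub_zero (KH H t u), ← hzero, KH_sub_eq_toReal hH1 (hs.trans hu.1) hs.le hst,
      ENNReal.toReal_pow]
  have hsub : s ∈ uIcc 0 t := by
    rw [uIcc_of_le ht]
    exact ⟨hs.le, hst⟩
  rw [hleft, hright, intervalIntegral.integral_add_adjacent_intervals
      (hint.mono_set (uIcc_subset_uIcc_left hsub)) (hint.mono_set (uIcc_subset_uIcc_right hsub)),
    intervalIntegral.integral_of_le ht,
    integral_toReal hGm2 (ae_lt_top' hGm2 hfin), hlin,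
    ENNReal.toReal_ofReal (Real.rpow_nonneg (sub_nonneg.2 hst) _)]
end
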